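/- arXiv:2211.04420 — 2 statements merged into one kernel-verified Lean document; each statement's English description precedes it below -/
import Mathlib

section
/- Let n and d be positive integers, let R = n % d, and let b : Fin d → ℕ satisfy b l = n / d + 1 (natural-number division) if (l : ℕ) < R and b l = n / d otherwise. Then Σ_{l : Fin d} | (b l : ℝ)/n − 1/d | = 2·R·(d − R) / (d·n). -/
/-- For a near-equal partition of `n` items into `d` bins (the first `R = n % d` bins have
size `⌊n/d⌋ + 1`, the rest size `⌊n/d⌋`), the ℓ¹ distance between the normalized bin-size
distribution and the uniform distribution on `Fin d` equals `2 R (d - R) / (d n)`. -/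
theorem binSize_l1_dist_to_uniform (n d : ℕ) (hn : 0 < n) (hd : 0 < d)
    (R : ℕ) (hR : R = n % d) (b : Fin d → ℕ)
    (hb : ∀ l : Fin d, b l = if (l : ℕ) < R then n / d + 1 else n / d) :
    ∑ l : Fin d, |(b l : ℝ) / n - 1 / d| = 2 * R * ((d : ℝ) - R) / (d * n) := by
  have hn' : (0 : ℝ) < n := by exact_mod_cast hn
  have hd' : (0 : ℝ) < d := by exact_mod_cast hd
  have hRd : R < d := hR ▸ Nat.mod_lt n hd
  have hdiv : (n : ℝ) = d * (n / d : ℕ) + R := by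
    rw [hR]
    exact_mod_cast (Nat.div_add_mod n d).symm
  have hterm (l : Fin d) : |(b l : ℝ) / n - 1 / d| =
      if (l : ℕ) < R then ((d : ℝ) - R) / (d * n) else (R : ℝ) / (d * n) := by
    have hcomb : (b l : ℝ) / n - 1 / d = (d * b l - n) / (d * n) := by
      field_simp
    rw [hcomb, abs_div, abs_of_pos (mul_pos hd' hn'), hb l]
    split_ifs
    · have hnum : (d : ℝ) * (n / d + 1 : ℕ) - n = d - R := by
        push_cast
        linarith
      rw [hnum, abs_of_pos (sub_pos.2 (by exact_mod_cast hRd))]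
    · have hnum : (d : ℝ) * (n / d : ℕ) - n = -R := by linarith
      rw [hnum, abs_neg, Nat.abs_cast]
  rw [Finset.sum_congr rfl fun l _ => hterm l,
    Fin.sum_univ_eq_sum_range
      (fun l => if l < R then ((d : ℝ) - R) / (d * n) else (R : ℝ) / (d * n)) d,
    ← Finset.sum_range_add_sum_Ico _ hRd.le,
    Finset.sum_congr rfl fun l hl => if_pos (Finset.mem_range.1 hl),
    Finset.sum_congr rfl fun l hl => if_neg (Finset.mem_Ico.1 hl).1.not_gt,
    Finset.sum_const, Finset.sum_const, Finset.card_range, Nat.card_Ico,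
    nsmul_eq_mul, nsmul_eq_mul, Nat.cast_sub hRd.le]
  ring
end

section
/- Let n and d be positive integers, let R = n % d, and let b : Fin d → ℕ satisfy b l = n / d + 1 (natural-number division) if (l : ℕ) < R and b l = n / d otherwise. Then (1/2) · Σ_{l : Fin d} | 1/d − (b l : ℝ)/n | < d / (2·n). -/
/-- For a near-equal partition of `n` items into `d` bins (the first `R = n % d` bins have
size `⌊n/d⌋ + 1`, the rest size `⌊n/d⌋`), the statistical (total-variation) distance between
the normalized bin-size distribution and the uniform distribution on `Fin d` is less than
`d / (2 n)`. -/
theorem binSize_statDist_lt (n d : ℕ) (hn : 0 < n) (hd : 0 < d)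
    (R : ℕ) (hR : R = n % d) (b : Fin d → ℕ)
    (hb : ∀ l : Fin d, b l = if (l : ℕ) < R then n / d + 1 else n / d) :
    (1 / 2 : ℝ) * ∑ l : Fin d, |1 / (d : ℝ) - (b l : ℝ) / n| < (d : ℝ) / (2 * n) := by
  have hn' : (0 : ℝ) < n := by exact_mod_cast hn
  have hd' : (0 : ℝ) < d := by exact_mod_cast hd
  have hdiv : (d : ℝ) * (n / d : ℕ) + R = n := by
    rw [hR]
    exact_mod_cast Nat.div_add_mod n d
  have hRd : (R : ℝ) < d := by
    rw [hR]
    exact_mod_cast Nat.mod_lt n hd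
  have hterm : ∀ l : Fin d, |1 / (d : ℝ) - (b l : ℝ) / n| < 1 / n := by
    intro l
    have habs : |(n : ℝ) - d * b l| < d := by
      rw [hb l, abs_lt]
      split_ifs with h
      · have hRpos : (0 : ℝ) < R := by exact_mod_cast (Nat.zero_le _).trans_lt h
        push_cast
        constructor <;> linarith
      · have hRnonneg : (0 : ℝ) ≤ R := R.cast_nonneg
        constructor <;> linarith
    have heq : 1 / (d : ℝ) - (b l : ℝ) / n = (n - d * b l) / (d * n) := by
      field_simp
    rw [heq, abs_div, abs_of_pos (mul_pos hd' hn'), div_lt_div_iff₀ (by positivity) hn']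
    nlinarith
  have hsum : ∑ l : Fin d, |1 / (d : ℝ) - (b l : ℝ) / n| < ∑ _l : Fin d, 1 / (n : ℝ) :=
    Finset.sum_lt_sum_of_nonempty ⟨⟨0, hd⟩, Finset.mem_univ _⟩ fun l _ => hterm l
  calc (1 / 2 : ℝ) * ∑ l : Fin d, |1 / (d : ℝ) - (b l : ℝ) / n|
      < 1 / 2 * ∑ _l : Fin d, 1 / (n : ℝ) := by linarith
    _ = (d : ℝ) / (2 * n) := by
      rw [Finset.sum_const, Finset.card_univ, Fintype.card_fin, nsmul_eq_mul]
      field_simp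
end
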